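/- With the data below, let f : M → A be a k-linear map such that f(M) ⊆ Z(ˢA), f is left H-linear (f(h·m) = ρ(h⊗f(m)) for all h ∈ H, m ∈ M), and f(m·h) = ε(h)f(m) for all h ∈ H, m ∈ M. Suppose M is generated as an H-bimodule by a family (mᵢ)_{i∈I}, and that for every i ∈ I and every a ∈ A one has f(mᵢ)·a = (μ_A∘(A⊗f)∘φ)(mᵢ⊗a). Then f is φ-central, i.e. f(m)·a = (μ_A∘(A⊗f)∘φ)(m⊗a) for all m ∈ M and a ∈ A. -/

import Mathlib

open TensorProduct LinearMap

noncomputable section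

variable {k H A M : Type*} [Field k] [Semiring H] [HopfAlgebra k H]
  [Ring A] [Algebra k A] [AddCommGroup M] [Module k M]

/-- `H` is cocommutative: `τ∘Δ = Δ`. -/
def HopfCocomm (k H : Type*) [Field k] [Semiring H] [HopfAlgebra k H] : Prop :=
  (TensorProduct.comm k H H).toLinearMap ∘ₗ Coalgebra.comul (R := k) = Coalgebra.comul (R := k)

/-- `s : H⊗A → A⊗H` is a left transposition of `H` on `A` (braid of `H` the flip). -/
structure IsTransposition (s : H ⊗[k] A →ₗ[k] A ⊗[k] H) : Prop where
  bij : Function.Bijective s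
  one_left : ∀ a : A, s ((1 : H) ⊗ₜ[k] a) = a ⊗ₜ[k] (1 : H)
  mul_H : s ∘ₗ rTensor A (LinearMap.mul' k H) =
    lTensor A (LinearMap.mul' k H) ∘ₗ (TensorProduct.assoc k A H H).toLinearMap
      ∘ₗ rTensor H s ∘ₗ (TensorProduct.assoc k H A H).symm.toLinearMap
      ∘ₗ lTensor H s ∘ₗ (TensorProduct.assoc k H H A).toLinearMap
  counit : (TensorProduct.rid k A).toLinearMap ∘ₗ lTensor A (Coalgebra.counit (R := k)) ∘ₗ s =
    (TensorProduct.lid k A).toLinearMap ∘ₗ rTensor A (Coalgebra.counit (R := k))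
  comul : lTensor A (Coalgebra.comul (R := k)) ∘ₗ s =
    (TensorProduct.assoc k A H H).toLinearMap ∘ₗ rTensor H s
      ∘ₗ (TensorProduct.assoc k H A H).symm.toLinearMap ∘ₗ lTensor H s
      ∘ₗ (TensorProduct.assoc k H H A).toLinearMap ∘ₗ rTensor A (Coalgebra.comul (R := k))
  braid : (TensorProduct.assoc k A H H).toLinearMap ∘ₗ rTensor H s
      ∘ₗ (TensorProduct.assoc k H A H).symm.toLinearMap ∘ₗ lTensor H s
      ∘ₗ (TensorProduct.assoc k H H A).toLinearMap
      ∘ₗ rTensor A (TensorProduct.comm k H H).toLinearMap =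
    lTensor A (TensorProduct.comm k H H).toLinearMap
      ∘ₗ (TensorProduct.assoc k A H H).toLinearMap ∘ₗ rTensor H s
      ∘ₗ (TensorProduct.assoc k H A H).symm.toLinearMap ∘ₗ lTensor H s
      ∘ₗ (TensorProduct.assoc k H H A).toLinearMap
  one_right : ∀ h : H, s (h ⊗ₜ[k] (1 : A)) = (1 : A) ⊗ₜ[k] h
  mul_A : s ∘ₗ lTensor H (LinearMap.mul' k A) =
    rTensor H (LinearMap.mul' k A) ∘ₗ (TensorProduct.assoc k A A H).symm.toLinearMap
      ∘ₗ lTensor A s ∘ₗ (TensorProduct.assoc k A H A).toLinearMap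
      ∘ₗ rTensor A s ∘ₗ (TensorProduct.assoc k H A A).symm.toLinearMap

/-- `(A, s)` is a left `H`-module algebra with action `ρ`. -/
structure IsModuleAlgebra (s : H ⊗[k] A →ₗ[k] A ⊗[k] H) (ρ : H ⊗[k] A →ₗ[k] A) : Prop where
  one_smul : ∀ a : A, ρ ((1 : H) ⊗ₜ[k] a) = a
  mul_smul : ρ ∘ₗ rTensor A (LinearMap.mul' k H) =
    ρ ∘ₗ lTensor H ρ ∘ₗ (TensorProduct.assoc k H H A).toLinearMap
  s_compat : s ∘ₗ lTensor H ρ =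
    rTensor H ρ ∘ₗ (TensorProduct.assoc k H A H).symm.toLinearMap ∘ₗ lTensor H s
      ∘ₗ (TensorProduct.assoc k H H A).toLinearMap
      ∘ₗ rTensor A (TensorProduct.comm k H H).toLinearMap
      ∘ₗ (TensorProduct.assoc k H H A).symm.toLinearMap
  smul_mul : ρ ∘ₗ lTensor H (LinearMap.mul' k A) =
    LinearMap.mul' k A ∘ₗ TensorProduct.map ρ ρ
      ∘ₗ (TensorProduct.assoc k H A (H ⊗[k] A)).symm.toLinearMap
      ∘ₗ lTensor H ((TensorProduct.assoc k A H A).toLinearMap ∘ₗ rTensor A s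
          ∘ₗ (TensorProduct.assoc k H A A).symm.toLinearMap)
      ∘ₗ (TensorProduct.assoc k H H (A ⊗[k] A)).toLinearMap
      ∘ₗ rTensor (A ⊗[k] A) (Coalgebra.comul (R := k))
  smul_one : ∀ h : H, ρ (h ⊗ₜ[k] (1 : A)) = Coalgebra.counit (R := k) h • (1 : A)

/-- `M` is an `H`-bimodule via `ρl` and `ρr`. -/
structure IsBimodule (ρl : H ⊗[k] M →ₗ[k] M) (ρr : M ⊗[k] H →ₗ[k] M) : Prop where
  one_left : ∀ m : M, ρl ((1 : H) ⊗ₜ[k] m) = m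
  mul_left : ρl ∘ₗ rTensor M (LinearMap.mul' k H) =
    ρl ∘ₗ lTensor H ρl ∘ₗ (TensorProduct.assoc k H H M).toLinearMap
  one_right : ∀ m : M, ρr (m ⊗ₜ[k] (1 : H)) = m
  mul_right : ρr ∘ₗ lTensor M (LinearMap.mul' k H) =
    ρr ∘ₗ rTensor H ρr ∘ₗ (TensorProduct.assoc k M H H).symm.toLinearMap
  assoc : ρr ∘ₗ rTensor H ρl = ρl ∘ₗ lTensor H ρr ∘ₗ (TensorProduct.assoc k H M H).toLinearMap

/-- `φ : M⊗A → A⊗M` is a transposition of the `H`-bimodule `M` on `(A, s)`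
(conditions (1)–(5) of Definition 5.2). -/
structure IsBimoduleTransposition (s : H ⊗[k] A →ₗ[k] A ⊗[k] H) (ρ : H ⊗[k] A →ₗ[k] A)
    (ρl : H ⊗[k] M →ₗ[k] M) (ρr : M ⊗[k] H →ₗ[k] M)
    (φ : M ⊗[k] A →ₗ[k] A ⊗[k] M) : Prop where
  one : ∀ m : M, φ (m ⊗ₜ[k] (1 : A)) = (1 : A) ⊗ₜ[k] m
  mul : φ ∘ₗ lTensor M (LinearMap.mul' k A) =
    rTensor M (LinearMap.mul' k A) ∘ₗ (TensorProduct.assoc k A A M).symm.toLinearMap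
      ∘ₗ lTensor A φ ∘ₗ (TensorProduct.assoc k A M A).toLinearMap
      ∘ₗ rTensor A φ ∘ₗ (TensorProduct.assoc k M A A).symm.toLinearMap
  action : φ ∘ₗ lTensor M ρ =
    rTensor M ρ ∘ₗ (TensorProduct.assoc k H A M).symm.toLinearMap ∘ₗ lTensor H φ
      ∘ₗ (TensorProduct.assoc k H M A).toLinearMap
      ∘ₗ rTensor A (TensorProduct.comm k M H).toLinearMap
      ∘ₗ (TensorProduct.assoc k M H A).symm.toLinearMap
  s_compat : rTensor H φ ∘ₗ (TensorProduct.assoc k M A H).symm.toLinearMap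
      ∘ₗ lTensor M s ∘ₗ (TensorProduct.assoc k M H A).toLinearMap
      ∘ₗ rTensor A (TensorProduct.comm k H M).toLinearMap
      ∘ₗ (TensorProduct.assoc k H M A).symm.toLinearMap =
    (TensorProduct.assoc k A M H).symm.toLinearMap
      ∘ₗ lTensor A (TensorProduct.comm k H M).toLinearMap
      ∘ₗ (TensorProduct.assoc k A H M).toLinearMap ∘ₗ rTensor M s
      ∘ₗ (TensorProduct.assoc k H A M).symm.toLinearMap ∘ₗ lTensor H φ
  right_action : φ ∘ₗ rTensor A ρr =
    lTensor A ρr ∘ₗ (TensorProduct.assoc k A M H).toLinearMap ∘ₗ rTensor H φ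
      ∘ₗ (TensorProduct.assoc k M A H).symm.toLinearMap
      ∘ₗ lTensor M s ∘ₗ (TensorProduct.assoc k M H A).toLinearMap
  left_action : φ ∘ₗ rTensor A ρl =
    lTensor A ρl ∘ₗ (TensorProduct.assoc k A H M).toLinearMap ∘ₗ rTensor M s
      ∘ₗ (TensorProduct.assoc k H A M).symm.toLinearMap
      ∘ₗ lTensor H φ ∘ₗ (TensorProduct.assoc k H M A).toLinearMap

open Coalgebra HopfAlgebra in
/-- In a cocommutative Hopf algebra, `∑ F (h₁ S(h₃) ⊗ h₂) = F (1 ⊗ h)` for every linear map `F`. -/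
theorem HopfCocomm.sum_mul_antipode_tmul {N κ Λ : Type*} [AddCommGroup N] [Module k N]
    (hcc : HopfCocomm k H) (F : H ⊗[k] H →ₗ[k] N) (h : H) (r : Coalgebra.Repr k h κ)
    (r₁ : ∀ i, Coalgebra.Repr k (r.left i) Λ) :
    ∑ i ∈ r.index, ∑ j ∈ (r₁ i).index,
      F (((r₁ i).left j * antipode k (r.right i)) ⊗ₜ[k] (r₁ i).right j) = F (1 ⊗ₜ[k] h) := by
  let r₂ : ∀ i, Coalgebra.Repr k (r.right i) (H × H) := fun i => Coalgebra.Repr.arbitrary k _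
  let G : H ⊗[k] (H ⊗[k] H) →ₗ[k] N :=
    F ∘ₗ rTensor H (LinearMap.mul' k H ∘ₗ lTensor H (antipode k)) ∘ₗ
      (TensorProduct.assoc k H H H).symm.toLinearMap
  have hG (p q t : H) : G (p ⊗ₜ (q ⊗ₜ t)) = F ((p * antipode k q) ⊗ₜ t) := by simp [G]
  let c : H ⊗[k] H →ₗ[k] H ⊗[k] H := (TensorProduct.comm k H H).toLinearMap
  have hc (x : H) : c (comul x) = comul x := LinearMap.congr_fun hcc x
  have coassoc := sum_tmul_tmul_eq r r₁ r₂
  have swap : ∑ i ∈ r.index, ∑ j ∈ (r₂ i).index,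
      r.left i ⊗ₜ[k] ((r₂ i).right j ⊗ₜ[k] (r₂ i).left j) =
      ∑ i ∈ r.index, ∑ j ∈ (r₂ i).index,
        r.left i ⊗ₜ[k] ((r₂ i).left j ⊗ₜ[k] (r₂ i).right j) := by
    refine Finset.sum_congr rfl fun i _ => ?_
    have e := hc (r.right i)
    rw [← (r₂ i).eq] at e
    simp only [c, map_sum, LinearEquiv.coe_coe, TensorProduct.comm_tmul] at e
    rw [← TensorProduct.tmul_sum, ← TensorProduct.tmul_sum, e]
  have e₁ := congrArg (fun z => G (lTensor H c z)) coassoc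
  simp only [map_sum, lTensor_tmul, c, LinearEquiv.coe_coe, TensorProduct.comm_tmul, hG] at e₁
  have e₂ := congrArg G (swap.trans coassoc.symm)
  simp only [map_sum, hG] at e₂
  rw [e₁, e₂]
  have e₃ (i) : ∑ j ∈ (r₁ i).index,
      F (((r₁ i).left j * antipode k ((r₁ i).right j)) ⊗ₜ[k] r.right i) =
      F (1 ⊗ₜ (counit (R := k) (r.left i) • r.right i)) := by
    rw [← map_sum, ← TensorProduct.sum_tmul, sum_mul_antipode_eq_smul, TensorProduct.smul_tmul]
  simp only [e₃]
  rw [← map_sum, ← TensorProduct.tmul_sum, sum_counit_smul]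

/-- The map `p ⊗ (a ⊗ h) ↦ (p · a) (h · b)`. -/
def smulMulSMul (ρ : H ⊗[k] A →ₗ[k] A) (b : A) : H ⊗[k] (A ⊗[k] H) →ₗ[k] A :=
  LinearMap.mul' k A ∘ₗ
    TensorProduct.map ρ (ρ ∘ₗ (TensorProduct.mk k H A).flip b) ∘ₗ
    (TensorProduct.assoc k H A H).symm.toLinearMap

@[simp]
theorem smulMulSMul_tmul (ρ : H ⊗[k] A →ₗ[k] A) (b : A) (p : H) (a : A) (h : H) :
    smulMulSMul ρ b (p ⊗ₜ (a ⊗ₜ h)) = ρ (p ⊗ₜ a) * ρ (h ⊗ₜ b) := by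
  simp [smulMulSMul]

namespace IsModuleAlgebra

variable {s : H ⊗[k] A →ₗ[k] A ⊗[k] H} {ρ : H ⊗[k] A →ₗ[k] A} {κ : Type*}

theorem mul_smul_apply (hρ : IsModuleAlgebra s ρ) (g h : H) (a : A) :
    ρ ((g * h) ⊗ₜ a) = ρ (g ⊗ₜ ρ (h ⊗ₜ a)) := by
  simpa using LinearMap.congr_fun hρ.mul_smul ((g ⊗ₜ h) ⊗ₜ a)

theorem s_smul_apply (hρ : IsModuleAlgebra s ρ) (g h : H) (a : A) :
    s (g ⊗ₜ ρ (h ⊗ₜ a)) =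
      rTensor H ρ ((TensorProduct.assoc k H A H).symm (h ⊗ₜ s (g ⊗ₜ a))) := by
  simpa using LinearMap.congr_fun hρ.s_compat (g ⊗ₜ (h ⊗ₜ a))

theorem smul_mul_apply (hρ : IsModuleAlgebra s ρ) (h : H) (r : Coalgebra.Repr k h κ) (a b : A) :
    ρ (h ⊗ₜ (a * b)) =
      ∑ i ∈ r.index, smulMulSMul ρ b (r.left i ⊗ₜ s (r.right i ⊗ₜ a)) := by
  have e := LinearMap.congr_fun hρ.smul_mul (h ⊗ₜ (a ⊗ₜ b))
  have key (p : H) (u : A ⊗[k] H) : LinearMap.mul' k A (TensorProduct.map ρ ρ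
      ((TensorProduct.assoc k H A (H ⊗[k] A)).symm
        (p ⊗ₜ (TensorProduct.assoc k A H A (u ⊗ₜ b))))) = smulMulSMul ρ b (p ⊗ₜ u) := by
    induction u with
    | zero => simp
    | tmul a h => simp
    | add u v hu hv => simp only [TensorProduct.add_tmul, TensorProduct.tmul_add, map_add, hu, hv]
  simp only [coe_comp, Function.comp_apply, lTensor_tmul, LinearMap.mul'_apply, rTensor_tmul,
    ← r.eq, TensorProduct.sum_tmul, map_sum, LinearEquiv.coe_coe, TensorProduct.assoc_tmul,
    TensorProduct.assoc_symm_tmul, key] at e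
  exact e

theorem smulMulSMul_smul (hρ : IsModuleAlgebra s ρ) (b : A) (p l : H) (u : A ⊗[k] H) :
    smulMulSMul ρ b (p ⊗ₜ rTensor H ρ ((TensorProduct.assoc k H A H).symm (l ⊗ₜ u))) =
      smulMulSMul ρ b ((p * l) ⊗ₜ u) := by
  induction u with
  | zero => simp
  | tmul a h => simp [hρ.mul_smul_apply]
  | add u v hu hv => simp only [TensorProduct.tmul_add, map_add, hu, hv]

open Coalgebra HopfAlgebra in
/-- `∑ h₁ · (b (S(h₂) · a)) = (h · b) a` when `s (g ⊗ b) = b ⊗ g` for all `g`. -/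
theorem sum_smul_mul_antipode_smul (hρ : IsModuleAlgebra s ρ) (h : H)
    (r : Coalgebra.Repr k h κ) (a b : A)
    (hb : ∀ g : H, s (g ⊗ₜ b) = b ⊗ₜ g) :
    ∑ i ∈ r.index, ρ (r.left i ⊗ₜ (b * ρ (antipode k (r.right i) ⊗ₜ a))) =
      ρ (h ⊗ₜ b) * a := by
  let r₁ : ∀ i, Coalgebra.Repr k (r.left i) (H × H) := fun i => Coalgebra.Repr.arbitrary k _
  let r₂ : ∀ i, Coalgebra.Repr k (r.right i) (H × H) := fun i => Coalgebra.Repr.arbitrary k _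
  let G : H ⊗[k] (H ⊗[k] H) →ₗ[k] A := LinearMap.mul' k A ∘ₗ
    TensorProduct.map (ρ ∘ₗ (TensorProduct.mk k H A).flip b)
      (ρ ∘ₗ (TensorProduct.mk k H A).flip a ∘ₗ LinearMap.mul' k H ∘ₗ lTensor H (antipode k))
  have hG (p q t : H) : G (p ⊗ₜ (q ⊗ₜ t)) = ρ (p ⊗ₜ b) * ρ ((q * antipode k t) ⊗ₜ a) := by
    simp [G]
  have e := congrArg G (sum_tmul_tmul_eq r r₁ r₂)
  simp only [map_sum, hG] at e
  simp only [fun i => hρ.smul_mul_apply (r.left i) (r₁ i), hb, smulMulSMul_tmul,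
    ← hρ.mul_smul_apply]
  rw [e]
  have e₂ (i) : ∑ j ∈ (r₂ i).index, ρ (r.left i ⊗ₜ b) *
      ρ (((r₂ i).left j * antipode k ((r₂ i).right j)) ⊗ₜ a) =
      ρ ((counit (R := k) (r.right i) • r.left i) ⊗ₜ b) * a := by
    rw [← Finset.mul_sum, ← map_sum, ← TensorProduct.sum_tmul, sum_mul_antipode_eq_smul,
      ← TensorProduct.smul_tmul', ← TensorProduct.smul_tmul', map_smul, map_smul, hρ.one_smul,
      mul_smul_comm, smul_mul_assoc]
  simp only [e₂]
  rw [← Finset.sum_mul, ← map_sum, ← TensorProduct.sum_tmul]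
  congr 3
  have := congrArg (TensorProduct.rid k H) (sum_tmul_counit_eq r)
  simpa only [map_sum, TensorProduct.rid_tmul, _root_.one_smul] using this

open Coalgebra HopfAlgebra in
/-- `∑ h₁ · ((S(h₂) · a) b) = ∑ x (g · b)` where `s (h ⊗ a) = ∑ x ⊗ g`. -/
theorem sum_smul_antipode_smul_mul (hρ : IsModuleAlgebra s ρ) (hcc : HopfCocomm k H)
    (h : H) (r : Coalgebra.Repr k h κ) (a b : A) :
    ∑ i ∈ r.index, ρ (r.left i ⊗ₜ (ρ (antipode k (r.right i) ⊗ₜ a) * b)) =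
      smulMulSMul ρ b (1 ⊗ₜ s (h ⊗ₜ a)) := by
  simp only [fun i => hρ.smul_mul_apply (r.left i) (Coalgebra.Repr.arbitrary k (r.left i)),
    hρ.s_smul_apply, hρ.smulMulSMul_smul]
  exact hcc.sum_mul_antipode_tmul
    (smulMulSMul ρ b ∘ₗ lTensor H (s ∘ₗ (TensorProduct.mk k H A).flip a)) h r
    (fun i => Coalgebra.Repr.arbitrary k (r.left i))

end IsModuleAlgebra

namespace IsBimoduleTransposition

variable {s : H ⊗[k] A →ₗ[k] A ⊗[k] H} {ρ : H ⊗[k] A →ₗ[k] A} {ρl : H ⊗[k] M →ₗ[k] M}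
  {ρr : M ⊗[k] H →ₗ[k] M} {φ : M ⊗[k] A →ₗ[k] A ⊗[k] M} {f : M →ₗ[k] A} {m : M}

theorem central_right_action (hφ : IsBimoduleTransposition s ρ ρl ρr φ) (hs : IsTransposition s)
    (hf_right : ∀ (m : M) (h : H),
      f (ρr (m ⊗ₜ[k] h)) = Coalgebra.counit (R := k) h • f m)
    (hm : ∀ a : A, f m * a = LinearMap.mul' k A (lTensor A f (φ (m ⊗ₜ[k] a)))) (h : H) (a : A) :
    f (ρr (m ⊗ₜ h)) * a = LinearMap.mul' k A (lTensor A f (φ (ρr (m ⊗ₜ h) ⊗ₜ[k] a))) := by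
  have key₁ (v : A ⊗[k] M) (h : H) : LinearMap.mul' k A (lTensor A f (lTensor A ρr
      (TensorProduct.assoc k A M H (v ⊗ₜ h)))) =
      Coalgebra.counit (R := k) h • LinearMap.mul' k A (lTensor A f v) := by
    induction v with
    | zero => simp
    | tmul a m => simp [hf_right]
    | add u v hu hv => simp only [TensorProduct.add_tmul, map_add, hu, hv, smul_add]
  have key₂ (u : A ⊗[k] H) : LinearMap.mul' k A (lTensor A f (lTensor A ρr
      (TensorProduct.assoc k A M H (rTensor H φ
        ((TensorProduct.assoc k M A H).symm (m ⊗ₜ u)))))) =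
      f m * TensorProduct.rid k A (lTensor A (Coalgebra.counit (R := k)) u) := by
    induction u with
    | zero => simp
    | tmul a h => simp [key₁, ← hm]
    | add u v hu hv => simp only [TensorProduct.tmul_add, map_add, hu, hv, mul_add]
  have e := LinearMap.congr_fun hφ.right_action ((m ⊗ₜ h) ⊗ₜ a)
  simp only [coe_comp, Function.comp_apply, rTensor_tmul, LinearEquiv.coe_coe,
    TensorProduct.assoc_tmul, lTensor_tmul] at e
  have e' := LinearMap.congr_fun hs.counit (h ⊗ₜ a)
  simp only [coe_comp, Function.comp_apply, rTensor_tmul, LinearEquiv.coe_coe,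
    TensorProduct.lid_tmul] at e'
  rw [e, key₂, e', hf_right, smul_mul_assoc, mul_smul_comm]

theorem central_left_action (hφ : IsBimoduleTransposition s ρ ρl ρr φ) (hcc : HopfCocomm k H)
    (hρ : IsModuleAlgebra s ρ) (hf_sA : ∀ h : H, s (h ⊗ₜ[k] f m) = f m ⊗ₜ[k] h)
    (hf_left : ∀ (h : H) (m : M), f (ρl (h ⊗ₜ[k] m)) = ρ (h ⊗ₜ[k] f m))
    (hm : ∀ a : A, f m * a = LinearMap.mul' k A (lTensor A f (φ (m ⊗ₜ[k] a)))) (h : H) (a : A) :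
    f (ρl (h ⊗ₜ m)) * a = LinearMap.mul' k A (lTensor A f (φ (ρl (h ⊗ₜ m) ⊗ₜ[k] a))) := by
  let r := Coalgebra.Repr.arbitrary k h
  have key₁ (u : A ⊗[k] H) (m : M) : LinearMap.mul' k A (lTensor A f (lTensor A ρl
      (TensorProduct.assoc k A H M (u ⊗ₜ m)))) = smulMulSMul ρ (f m) (1 ⊗ₜ u) := by
    induction u with
    | zero => simp
    | tmul a h => simp [hf_left, hρ.one_smul]
    | add u v hu hv => simp only [TensorProduct.tmul_add, TensorProduct.add_tmul, map_add, hu, hv]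
  have key₂ (v : A ⊗[k] M) : ∑ i ∈ r.index, ρ (r.left i ⊗ₜ LinearMap.mul' k A (lTensor A f
      (rTensor M ρ ((TensorProduct.assoc k H A M).symm
        (HopfAlgebra.antipode k (r.right i) ⊗ₜ v))))) =
      LinearMap.mul' k A (lTensor A f (lTensor A ρl (TensorProduct.assoc k A H M
        (rTensor M s ((TensorProduct.assoc k H A M).symm (h ⊗ₜ v)))))) := by
    induction v with
    | zero => simp
    | tmul a m => simpa [key₁] using hρ.sum_smul_antipode_smul_mul hcc h r a (f m)
    | add u v hu hv =>
      simp only [TensorProduct.tmul_add, map_add, Finset.sum_add_distrib, hu, hv]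
  have e := LinearMap.congr_fun hφ.left_action ((h ⊗ₜ m) ⊗ₜ a)
  simp only [coe_comp, Function.comp_apply, rTensor_tmul, LinearEquiv.coe_coe,
    TensorProduct.assoc_tmul, lTensor_tmul] at e
  have e' (g : H) : φ (m ⊗ₜ ρ (g ⊗ₜ a)) =
      rTensor M ρ ((TensorProduct.assoc k H A M).symm (g ⊗ₜ φ (m ⊗ₜ a))) := by
    simpa using LinearMap.congr_fun hφ.action (m ⊗ₜ (g ⊗ₜ a))
  rw [e, ← key₂, hf_left, ← hρ.sum_smul_mul_antipode_smul h r a (f m) hf_sA]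
  simp only [hm, e']

end IsBimoduleTransposition

/-- Proposition 5.5: if `f : M → Z(ˢA)` is an `H`-bimodule map and
`f(mᵢ)·a = (μ_A∘(A⊗f)∘φ)(mᵢ⊗a)` holds on a family of `H`-bimodule generators of `M`,
then `f` is `φ`-central. -/
theorem bimodule_map_phi_central_of_generators
    (hcc : HopfCocomm k H)
    (s : H ⊗[k] A →ₗ[k] A ⊗[k] H) (hs : IsTransposition s)
    (ρ : H ⊗[k] A →ₗ[k] A) (hρ : IsModuleAlgebra s ρ)
    (ρl : H ⊗[k] M →ₗ[k] M) (ρr : M ⊗[k] H →ₗ[k] M) (hM : IsBimodule ρl ρr)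
    (φ : M ⊗[k] A →ₗ[k] A ⊗[k] M) (hφ : IsBimoduleTransposition s ρ ρl ρr φ)
    (f : M →ₗ[k] A)
    -- `f(M) ⊆ ˢA`
    (hf_sA : ∀ (m : M) (h : H), s (h ⊗ₜ[k] f m) = f m ⊗ₜ[k] h)
    -- `f(M) ⊆ Z(ˢA)`
    (hf_center : ∀ (m : M) (b : A), (∀ h : H, s (h ⊗ₜ[k] b) = b ⊗ₜ[k] h) →
        f m * b = b * f m)
    -- `f` is left `H`-linear
    (hf_left : ∀ (h : H) (m : M), f (ρl (h ⊗ₜ[k] m)) = ρ (h ⊗ₜ[k] f m))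
    -- `f` is right `H`-linear into `Z(ˢA)⁺` (trivial right action)
    (hf_right : ∀ (m : M) (h : H),
        f (ρr (m ⊗ₜ[k] h)) = Coalgebra.counit (R := k) h • f m)
    -- generators
    (ι : Type*) (mgen : ι → M)
    (hgen : Submodule.span k
        {x : M | ∃ (i : ι) (h l : H), x = ρl (h ⊗ₜ[k] ρr (mgen i ⊗ₜ[k] l))} = ⊤)
    (hcentral_gen : ∀ (i : ι) (a : A),
        f (mgen i) * a = LinearMap.mul' k A ((lTensor A f) (φ (mgen i ⊗ₜ[k] a)))) :
    ∀ (m : M) (a : A),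
      f m * a = LinearMap.mul' k A ((lTensor A f) (φ (m ⊗ₜ[k] a))) := by
  intro m a
  have hm : m ∈ Submodule.span k
      {x : M | ∃ (i : ι) (h l : H), x = ρl (h ⊗ₜ[k] ρr (mgen i ⊗ₜ[k] l))} :=
    hgen ▸ Submodule.mem_top
  induction hm using Submodule.span_induction with
  | mem x hx =>
    obtain ⟨i, h, l, rfl⟩ := hx
    exact hφ.central_left_action hcc hρ (hf_sA _) hf_left
      (hφ.central_right_action hs hf_right (hcentral_gen i) l) h a
  | zero => simp
  | add x y _ _ hx hy => simp only [TensorProduct.add_tmul, map_add, add_mul, hx, hy]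
  | smul c x _ hx => simp only [← TensorProduct.smul_tmul', map_smul, smul_mul_assoc, hx]
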